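/- For every positive integer k, P(#K(n) = k for infinitely many n) ≥ (1 - 2q)^k. -/

import Mathlib

open MeasureTheory ProbabilityTheory Filter Set
open scoped ENNReal NNReal

variable {Ω : Type*}

/-- Partial sums of the steps: `S X n = X 0 + ⋯ + X (n-1)` (the walk started at `0`). -/
noncomputable def S (X : ℕ → Ω → ℤ) (n : ℕ) (ω : Ω) : ℤ :=
  ∑ i ∈ Finset.range n, X i ω

/-- The local time at site `z` up to time `n`: `ξ(z,n) = #{k : 0 < k ≤ n, S_k = z}`. -/
noncomputable def localTime (X : ℕ → Ω → ℤ) (z : ℤ) (n : ℕ) (ω : Ω) : ℕ :=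
  ((Finset.Icc 1 n).filter (fun k => S X k ω = z)).card

/-- The maximal local time `ξ(n) = max_{y ∈ ℤ} ξ(y,n)`. -/
noncomputable def maxLocalTime (X : ℕ → Ω → ℤ) (n : ℕ) (ω : Ω) : ℕ :=
  sSup (Set.range fun z : ℤ => localTime X z n ω)

/-- The set of favorite sites at time `n`: `K(n) = {z : ξ(z,n) = ξ(n)}`. -/
noncomputable def favSites (X : ℕ → Ω → ℤ) (n : ℕ) (ω : Ω) : Set ℤ :=
  {z : ℤ | localTime X z n ω = maxLocalTime X n ω}

/-- The total local time at site `z`: `ξ(z,∞) = #{k > 0 : S_k = z}` (as an extended natural). -/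
noncomputable def totalLocalTime (X : ℕ → Ω → ℤ) (z : ℤ) (ω : Ω) : ℕ∞ :=
  {k : ℕ | 0 < k ∧ S X k ω = z}.encard

/-- `X` is a sequence of i.i.d. steps with `P(X_i = 1) = p`, `P(X_i = -1) = q`. -/
def IsAsymmetricSRW [MeasurableSpace Ω] (P : Measure Ω) (X : ℕ → Ω → ℤ) (p q : ℝ) : Prop :=
  (∀ i, Measurable (X i)) ∧
  iIndepFun X P ∧
  (∀ i, P {ω | X i ω = 1} = ENNReal.ofReal p) ∧
  (∀ i, P {ω | X i ω = -1} = ENNReal.ofReal q)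
lemma lt_succ' (X : ℕ → Ω → ℤ) (z : ℤ) (n : ℕ) (ω : Ω) :
    localTime X z (n+1) ω = localTime X z n ω + if S X (n+1) ω = z then 1 else 0 := by
  unfold localTime
  rw [← Finset.insert_Icc_right_eq_Icc_add_one (by omega), Finset.filter_insert]
  split_ifs with h
  · rw [Finset.card_insert_of_notMem (by simp)]
  · rfl

lemma lt_le_n (X : ℕ → Ω → ℤ) (z : ℤ) (n : ℕ) (ω : Ω) : localTime X z n ω ≤ n := by
  unfold localTime
  exact (Finset.card_filter_le _ _).trans (by simp)

lemma lt_bdd (X : ℕ → Ω → ℤ) (n : ℕ) (ω : Ω) :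
    BddAbove (Set.range fun z : ℤ => localTime X z n ω) :=
  ⟨n, by rintro _ ⟨z, rfl⟩; exact lt_le_n X z n ω⟩

lemma lt_le_max (X : ℕ → Ω → ℤ) (z : ℤ) (n : ℕ) (ω : Ω) :
    localTime X z n ω ≤ maxLocalTime X n ω :=
  le_csSup (lt_bdd X n ω) ⟨z, rfl⟩

lemma max_le' (X : ℕ → Ω → ℤ) (n m : ℕ) (ω : Ω) (h : ∀ z, localTime X z n ω ≤ m) :
    maxLocalTime X n ω ≤ m :=
  csSup_le (Set.range_nonempty _) (by rintro _ ⟨z, rfl⟩; exact h z)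

lemma max_le_n (X : ℕ → Ω → ℤ) (n : ℕ) (ω : Ω) : maxLocalTime X n ω ≤ n :=
  max_le' X n n ω (fun z => lt_le_n X z n ω)

def Bset (X : ℕ → Ω → ℤ) (j m n : ℕ) : Set Ω :=
  {ω | maxLocalTime X n ω = m ∧ (favSites X n ω).ncard = j ∧ S X n ω ∈ favSites X n ω ∧
    ∀ z ∈ favSites X n ω, z ≤ S X n ω}

lemma base_step (X : ℕ → Ω → ℤ) (m : ℕ) (hm : 1 ≤ m) (ω : Ω)
    (h : ∃ n, m ≤ maxLocalTime X n ω) : ∃ n, ω ∈ Bset X 1 m n := by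
  classical
  obtain ⟨n, hn, hmin⟩ : ∃ n, m ≤ maxLocalTime X n ω ∧ ∀ i < n, maxLocalTime X i ω < m :=
    ⟨Nat.find h, Nat.find_spec h, fun i hi => not_le.1 (Nat.find_min h hi)⟩
  have h0 : n ≠ 0 := by
    rintro rfl
    have := max_le_n X 0 ω
    omega
  obtain ⟨n, rfl⟩ := Nat.exists_eq_succ_of_ne_zero h0
  have hlt := hmin n (by omega)
  have hle : ∀ z, localTime X z n ω ≤ m - 1 := fun z => by
    have := lt_le_max X z n ω
    omega
  have hmax : maxLocalTime X (n+1) ω = m := by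
    refine le_antisymm (max_le' _ _ _ _ fun z => ?_) hn
    rw [lt_succ']
    have := hle z
    split_ifs <;> omega
  have hS : ∀ z, localTime X z (n+1) ω = m → z = S X (n+1) ω := by
    intro z hz
    rw [lt_succ'] at hz
    have := hle z
    by_contra hne
    rw [if_neg (fun h => hne h.symm)] at hz
    omega
  have hmem : ∃ z, localTime X z (n+1) ω = maxLocalTime X (n+1) ω :=
    Nat.sSup_mem (Set.range_nonempty fun z : ℤ => localTime X z (n+1) ω) (lt_bdd X (n+1) ω)
  obtain ⟨z, hz⟩ := hmem
  have hzS := hS z (hz.trans hmax)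
  have hK : favSites X (n+1) ω = {S X (n+1) ω} := by
    ext y
    simp only [favSites, Set.mem_ofPred_eq, Set.mem_singleton_iff]
    constructor
    · intro hy; exact hS y (hy.trans hmax)
    · rintro rfl; rw [← hzS]; exact hz
  refine ⟨n+1, hmax, ?_, ?_, ?_⟩
  · rw [hK]; simp
  · rw [hK]; simp
  · rw [hK]; simp

lemma ind_step (X : ℕ → Ω → ℤ) (j m n : ℕ) (hj : 1 ≤ j) (ω : Ω)
    (hB : ω ∈ Bset X j m n) (hE : ∀ i, S X n ω < S X (n+i+1) ω)
    (h : ∃ n', n ≤ n' ∧ m + 1 ≤ maxLocalTime X n' ω) : ∃ n', ω ∈ Bset X (j+1) m n' := by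
  by_contra hcon
  push Not at hcon
  obtain ⟨h1, h2, h3, h4⟩ := hB
  have key : ∀ i, maxLocalTime X (n+i) ω = m ∧ favSites X (n+i) ω = favSites X n ω := by
    intro i
    induction i with
    | zero => exact ⟨h1, rfl⟩
    | succ i ih =>
      obtain ⟨ih1, ih2⟩ := ih
      have hlt := hE i
      have hnot : S X (n+i+1) ω ∉ favSites X (n+i) ω := by
        rw [ih2]; intro hm; have := h4 _ hm; omega
      have hle : localTime X (S X (n+i+1) ω) (n+i) ω < m := by
        have h5 := lt_le_max X (S X (n+i+1) ω) (n+i) ω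
        have h6 : localTime X (S X (n+i+1) ω) (n+i) ω ≠ maxLocalTime X (n+i) ω := hnot
        omega
      have hne : ∀ z, z ≠ S X (n+i+1) ω → localTime X z (n+i+1) ω = localTime X z (n+i) ω := by
        intro z hz
        rw [lt_succ', if_neg (fun h => hz h.symm)]; rfl
      have heq : localTime X (S X (n+i+1) ω) (n+i+1) ω
          = localTime X (S X (n+i+1) ω) (n+i) ω + 1 := by
        rw [lt_succ', if_pos rfl]
      have hSn : S X n ω ≠ S X (n+i+1) ω := by omega
      have hmax : maxLocalTime X (n+i+1) ω = m := by
        apply le_antisymm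
        · refine max_le' _ _ _ _ fun z => ?_
          by_cases hz : z = S X (n+i+1) ω
          · rw [hz, heq]; omega
          · rw [hne z hz, ← ih1]; exact lt_le_max _ _ _ _
        · have h7 : S X n ω ∈ favSites X (n+i) ω := by rw [ih2]; exact h3
          have h8 : localTime X (S X n ω) (n+i) ω = maxLocalTime X (n+i) ω := h7
          rw [← ih1, ← h8, ← hne _ hSn]
          exact lt_le_max _ _ _ _
      have hK : ∀ z, z ≠ S X (n+i+1) ω → (z ∈ favSites X (n+i+1) ω ↔ z ∈ favSites X n ω) := by
        intro z hz
        rw [← ih2]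
        simp only [favSites, Set.mem_ofPred_eq]
        rw [hne z hz, hmax, ih1]
      refine ⟨hmax, ?_⟩
      by_cases hc : localTime X (S X (n+i+1) ω) (n+i) ω + 1 = m
      · exfalso
        have hin : S X (n+i+1) ω ∈ favSites X (n+i+1) ω := by
          simp only [favSites, Set.mem_ofPred_eq]
          rw [heq, hc, hmax]
        have hins : favSites X (n+i+1) ω = insert (S X (n+i+1) ω) (favSites X n ω) := by
          ext z
          by_cases hz : z = S X (n+i+1) ω
          · subst hz; simp [hin]
          · rw [hK z hz]; simp [hz]
        refine hcon (n+i+1) ⟨hmax, ?_, hin, ?_⟩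
        · rw [hins, Set.ncard_insert_of_notMem (by rwa [← ih2])
            (Set.finite_of_ncard_pos (by omega)), h2]
        · rw [hins]
          intro z hz
          rcases hz with rfl | hz
          · exact le_rfl
          · have := h4 z hz
            omega
      · ext z
        by_cases hz : z = S X (n+i+1) ω
        · subst hz
          rw [← ih2]
          refine iff_of_false ?_ hnot
          show ¬ (localTime X _ (n+i+1) ω = maxLocalTime X (n+i+1) ω)
          rw [heq, hmax]; exact hc
        · exact hK z hz
  obtain ⟨n', hn', hm'⟩ := h
  obtain ⟨i, rfl⟩ := Nat.exists_eq_add_of_le hn'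
  have := (key i).1
  omega

/-! determinacy and independence -/

def Det (X : ℕ → Ω → ℤ) (s : Finset ℕ) {β : Type*} (f : Ω → β) : Prop :=
  ∀ ω ω', (∀ i ∈ s, X i ω = X i ω') → f ω = f ω'

lemma Det.factor {X : ℕ → Ω → ℤ} {s : Finset ℕ} {β : Type*} [Nonempty β] {f : Ω → β}
    (h : Det X s f) : ∃ g : (s → ℤ) → β, f = g ∘ (fun ω (i : s) => X i ω) := by
  have hf : Function.FactorsThrough f (fun ω (i : s) => X i ω) := by
    intro a b hab
    exact h a b fun i hi => congrFun hab ⟨i, hi⟩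
  inhabit β
  refine ⟨Function.extend (fun ω (i : s) => X i ω) f (fun _ => default), ?_⟩
  exact (hf.extend_comp _).symm

lemma Det.measurable [MeasurableSpace Ω] {X : ℕ → Ω → ℤ} {s : Finset ℕ} {β : Type*} [Nonempty β]
    [MeasurableSpace β] {f : Ω → β} (hX : ∀ i, Measurable (X i))
    (h : Det X s f) : Measurable f := by
  obtain ⟨g, rfl⟩ := h.factor
  exact (measurable_of_countable g).comp (measurable_pi_lambda _ fun i => hX i)

lemma Det.indep [MeasurableSpace Ω] {P : Measure Ω} {X : ℕ → Ω → ℤ} {s t : Finset ℕ}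
    {β γ : Type*} [Nonempty β] [Nonempty γ]
    [MeasurableSpace β] [MeasurableSpace γ] {f : Ω → β} {g : Ω → γ} (hX : ∀ i, Measurable (X i))
    (hI : iIndepFun X P) (hst : Disjoint s t)
    (hf : Det X s f) (hg : Det X t g) : IndepFun f g P := by
  obtain ⟨f', rfl⟩ := hf.factor
  obtain ⟨g', rfl⟩ := hg.factor
  exact (hI.indepFun_finset s t hst hX).comp (measurable_of_countable f') (measurable_of_countable g')

lemma Det.measurableSet [MeasurableSpace Ω] {X : ℕ → Ω → ℤ} {s : Finset ℕ}
    {A : Set Ω} (hX : ∀ i, Measurable (X i))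
    (h : Det X s (· ∈ A)) : MeasurableSet A :=
  measurableSet_setOfPred.2 (h.measurable hX)

lemma Det.inter_mul [MeasurableSpace Ω] {P : Measure Ω} {X : ℕ → Ω → ℤ} {s t : Finset ℕ}
    {A B : Set Ω} (hX : ∀ i, Measurable (X i))
    (hI : iIndepFun X P) (hst : Disjoint s t)
    (hf : Det X s (· ∈ A)) (hg : Det X t (· ∈ B)) : P (A ∩ B) = P A * P B := by
  have := (hf.indep hX hI hst hg).measure_inter_preimage_eq_mul {True} {True}
    (measurableSet_singleton _) (measurableSet_singleton _)
  have e : ∀ C : Set Ω, (fun ω => ω ∈ C) ⁻¹' {True} = C := by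
    intro C; ext; simp
  rwa [e, e] at this

lemma S_det (X : ℕ → Ω → ℤ) {k n : ℕ} (hk : k ≤ n) : Det X (Finset.range n) (S X k) := by
  intro ω ω' h
  unfold S
  refine Finset.sum_congr rfl fun i hi => h i ?_
  simp at hi ⊢; omega

lemma lt_det (X : ℕ → Ω → ℤ) (z : ℤ) (n : ℕ) : Det X (Finset.range n) (localTime X z n) := by
  intro ω ω' h
  unfold localTime
  congr 1
  refine Finset.filter_congr fun k hk => ?_
  rw [S_det X (Finset.mem_Icc.1 hk).2 ω ω' h]

lemma B_det (X : ℕ → Ω → ℤ) (j m n : ℕ) : Det X (Finset.range n) (· ∈ Bset X j m n) := by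
  intro ω ω' h
  have h1 : ∀ z, localTime X z n ω = localTime X z n ω' := fun z => lt_det X z n ω ω' h
  have h2 : maxLocalTime X n ω = maxLocalTime X n ω' := by
    unfold maxLocalTime; simp only [h1]
  have h3 : favSites X n ω = favSites X n ω' := by
    unfold favSites; simp only [h1, h2]
  have h4 := S_det X le_rfl ω ω' h
  simp only [Bset, Set.mem_ofPred_eq, h2, h3, h4]

/-! escape probability -/

def Tset (X : ℕ → Ω → ℤ) (n N : ℕ) : Set Ω := {ω | ∀ i < N, S X n ω < S X (n+i+1) ω}

lemma T_det (X : ℕ → Ω → ℤ) (n N : ℕ) : Det X (Finset.Ico n (n+N)) (· ∈ Tset X n N) := by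
  intro ω ω' h
  have key : ∀ i ≤ N, S X (n+i) ω - S X n ω = S X (n+i) ω' - S X n ω' := by
    intro i
    induction i with
    | zero => simp
    | succ i ih =>
      intro hi
      have := ih (by omega)
      have h5 := h (n+i) (by simp; omega)
      have e : ∀ ω, S X (n+(i+1)) ω = S X (n+i) ω + X (n+i) ω := fun ω => by
        unfold S; rw [← add_assoc, Finset.sum_range_succ]
      rw [e, e]; omega
  simp only [Tset, Set.mem_ofPred_eq, eq_iff_iff]
  refine forall₂_congr fun i hi => ?_
  have := key (i+1) (by omega)
  rw [← add_assoc] at this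
  omega

lemma S_succ (X : ℕ → Ω → ℤ) (n : ℕ) (ω : Ω) : S X (n+1) ω = S X n ω + X n ω := by
  unfold S; rw [Finset.sum_range_succ]

lemma step_exp [MeasurableSpace Ω] (P : Measure Ω) [IsProbabilityMeasure P]
    (X : ℕ → Ω → ℤ) (p q : ℝ) (hq0 : 0 < q) (hq : q < 1/2) (hpq : p + q = 1)
    (hX : IsAsymmetricSRW P X p q) (n : ℕ) :
    ∫⁻ ω, ENNReal.ofReal ((q/p) ^ (X n ω)) ∂P ≤ 1 := by
  obtain ⟨hm, hI, h1, h2⟩ := hX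
  have hp : 0 < p := by linarith
  have m1 : MeasurableSet {ω | X n ω = 1} := hm n (measurableSet_singleton 1)
  have m2 : MeasurableSet {ω | X n ω = -1} := hm n (measurableSet_singleton (-1))
  have hae : ∀ᵐ ω ∂P, X n ω = 1 ∨ X n ω = -1 := by
    have hu : P ({ω | X n ω = 1} ∪ {ω | X n ω = -1}) = 1 := by
      rw [measure_union _ m2, h1, h2, ← ENNReal.ofReal_add hp.le hq0.le, hpq, ENNReal.ofReal_one]
      rw [Set.disjoint_left]
      intro ω ha hb
      simp only [Set.mem_ofPred_eq] at ha hb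
      omega
    have := (prob_compl_eq_zero_iff (m1.union m2)).2 hu
    exact this
  calc ∫⁻ ω, ENNReal.ofReal ((q/p) ^ (X n ω)) ∂P
      ≤ ∫⁻ ω, (({ω | X n ω = 1}.indicator (fun _ => ENNReal.ofReal (q/p)) ω)
          + ({ω | X n ω = -1}.indicator (fun _ => ENNReal.ofReal (p/q)) ω)) ∂P := by
        apply lintegral_mono_ae
        filter_upwards [hae] with ω hω
        rcases hω with h | h
        · simp [Set.indicator, h]
        · simp [Set.indicator, h]
    _ = 1 := by
        rw [lintegral_add_left (measurable_const.indicator m1), lintegral_indicator_const m1,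
          lintegral_indicator_const m2, h1, h2, ← ENNReal.ofReal_mul (by positivity),
          ← ENNReal.ofReal_mul (by positivity), ← ENNReal.ofReal_add (by positivity) (by positivity)]
        rw [← ENNReal.ofReal_one]
        congr 1
        field_simp
        linarith

lemma T_anti (X : ℕ → Ω → ℤ) (n N : ℕ) : Tset X n (N+1) ⊆ Tset X n N :=
  fun _ h i hi => h i (by omega)

lemma T_prob [MeasurableSpace Ω] (P : Measure Ω) [IsProbabilityMeasure P]
    (X : ℕ → Ω → ℤ) (p q : ℝ) (hq0 : 0 < q) (hq : q < 1/2) (hpq : p + q = 1)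
    (hX : IsAsymmetricSRW P X p q) (n N : ℕ) :
    ENNReal.ofReal (1 - 2*q) ≤ P (Tset X n (N+1)) := by
  have hstep := step_exp P X p q hq0 hq hpq hX
  obtain ⟨hm, hI, h1, h2⟩ := hX
  have hp : 0 < p := by linarith
  have hr : 0 < q/p := by positivity
  have hr1 : q/p ≤ 1 := by rw [div_le_one hp]; linarith
  have hTm : ∀ N, MeasurableSet (Tset X n N) := fun N => (T_det X n N).measurableSet hm
  have hSm : ∀ n, Measurable (S X n) := fun n => (S_det X le_rfl).measurable hm
  set W : ℕ → Ω → ℝ≥0∞ := fun N ω => ENNReal.ofReal ((q/p) ^ (S X (n+N) ω - S X n ω)) with hW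
  have hWdet : ∀ N, Det X (Finset.range (n+N)) (W N) := by
    intro N ω ω' h
    simp only [hW]
    rw [S_det X le_rfl ω ω' h, S_det X (Nat.le_add_right n N) ω ω' h]
  have hWm : ∀ N, Measurable (W N) := fun N => (hWdet N).measurable hm
  suffices h : ENNReal.ofReal (1-2*q) + ∫⁻ ω in Tset X n (N+1), W (N+1) ω ∂P
      ≤ P (Tset X n (N+1)) from le_self_add.trans h
  induction N with
  | zero =>
    have hb : ENNReal.ofReal p ≤ P (Tset X n 1) := by
      rw [← h1 n]
      apply measure_mono
      intro ω hω i hi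
      obtain rfl : i = 0 := by omega
      simp only [Set.mem_ofPred_eq] at hω
      rw [add_zero, S_succ]; omega
    have ha : ∫⁻ ω in Tset X n 1, W 1 ω ∂P ≤ ENNReal.ofReal (q/p) * P (Tset X n 1) := by
      rw [← setLIntegral_const]
      apply setLIntegral_mono measurable_const
      intro ω hω
      have h0 : S X n ω < S X (n+0+1) ω := hω 0 (by omega)
      rw [add_zero] at h0
      apply ENNReal.ofReal_le_ofReal
      calc (q/p) ^ (S X (n+1) ω - S X n ω) ≤ (q/p) ^ (1:ℤ) :=
            zpow_le_zpow_right_of_le_one₀ hr hr1 (by omega)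
        _ = q/p := zpow_one _
    have e1 : ENNReal.ofReal (1-2*q) = ENNReal.ofReal (1 - q/p) * ENNReal.ofReal p := by
      rw [← ENNReal.ofReal_mul (by linarith)]
      congr 1
      field_simp
      linarith
    calc _ ≤ ENNReal.ofReal (1 - q/p) * P (Tset X n 1)
          + ENNReal.ofReal (q/p) * P (Tset X n 1) := by
            rw [e1]
            exact add_le_add (mul_le_mul_right hb _) ha
      _ = P (Tset X n 1) := by
            rw [← add_mul, ← ENNReal.ofReal_add (by linarith) hr.le]
            simp
  | succ N ih =>
    set M := N+1
    have hsplit : Tset X n M = Tset X n (M+1) ∪ (Tset X n M \ Tset X n (M+1)) :=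
      (Set.union_sdiff_cancel (T_anti X n M)).symm
    have hd : MeasurableSet (Tset X n M \ Tset X n (M+1)) := (hTm M).diff (hTm (M+1))
    have hdisj : Disjoint (Tset X n (M+1)) (Tset X n M \ Tset X n (M+1)) := disjoint_sdiff_right
    have hP : P (Tset X n M) = P (Tset X n (M+1)) + P (Tset X n M \ Tset X n (M+1)) := by
      conv_lhs => rw [hsplit]
      exact measure_union hdisj hd
    have hA : ∫⁻ ω in Tset X n (M+1), W (M+1) ω ∂P + P (Tset X n M \ Tset X n (M+1))
        ≤ ∫⁻ ω in Tset X n M, W (M+1) ω ∂P := by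
      conv_rhs => rw [hsplit]
      rw [lintegral_union hd hdisj]
      gcongr
      rw [← setLIntegral_one]
      apply setLIntegral_mono (hWm _)
      rintro ω ⟨ha, hb⟩
      have h0 : S X (n+(M+1)) ω ≤ S X n ω := by
        by_contra hc
        apply hb
        intro i hi
        by_cases hiM : i < M
        · exact ha i hiM
        · obtain rfl : i = M := by omega
          rw [add_assoc]; omega
      rw [hW, ← ENNReal.ofReal_one]
      apply ENNReal.ofReal_le_ofReal
      exact one_le_zpow_of_nonpos₀ hr hr1 (by omega)
    have hB : ∫⁻ ω in Tset X n M, W (M+1) ω ∂P ≤ ∫⁻ ω in Tset X n M, W M ω ∂P := by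
      rw [← lintegral_indicator (hTm M), ← lintegral_indicator (hTm M)]
      have e : (Tset X n M).indicator (W (M+1)) = ((Tset X n M).indicator (W M)) *
          (fun ω => ENNReal.ofReal ((q/p) ^ (X (n+M) ω))) := by
        ext ω
        simp only [Pi.mul_apply]
        by_cases hω : ω ∈ Tset X n M
        · rw [Set.indicator_of_mem hω, Set.indicator_of_mem hω]
          simp only [hW]
          rw [← ENNReal.ofReal_mul (by positivity), ← zpow_add₀ hr.ne', ← add_assoc, S_succ]
          congr 2
          ring
        · simp [Set.indicator_of_notMem hω]
      have hdet1 : Det X (Finset.range (n+M)) ((Tset X n M).indicator (W M)) := by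
        intro ω ω' h
        have a1 := hWdet M ω ω' h
        have a2 := T_det X n M ω ω' (fun i hi => h i (by simp at hi ⊢; omega))
        simp only [eq_iff_iff] at a2
        by_cases hω : ω ∈ Tset X n M
        · rw [Set.indicator_of_mem hω, Set.indicator_of_mem (a2.1 hω), a1]
        · rw [Set.indicator_of_notMem hω, Set.indicator_of_notMem (fun h => hω (a2.2 h))]
      have hdet2 : Det X {n+M} (fun ω => ENNReal.ofReal ((q/p) ^ (X (n+M) ω))) := by
        intro ω ω' h
        simp only [h (n+M) (by simp)]
      have hi := hdet1.indep hm hI (by simp) hdet2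
      calc ∫⁻ ω, (Tset X n M).indicator (W (M+1)) ω ∂P
          = ∫⁻ ω, (((Tset X n M).indicator (W M)) *
          (fun ω => ENNReal.ofReal ((q/p) ^ (X (n+M) ω)))) ω ∂P := by rw [e]
        _ = (∫⁻ ω, (Tset X n M).indicator (W M) ω ∂P) *
            ∫⁻ ω, ENNReal.ofReal ((q/p) ^ (X (n+M) ω)) ∂P :=
            lintegral_mul_eq_lintegral_mul_lintegral_of_indepFun (hdet1.measurable hm)
              (hdet2.measurable hm) hi
        _ ≤ (∫⁻ ω, (Tset X n M).indicator (W M) ω ∂P) * 1 := mul_le_mul_right (hstep _) _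
        _ = _ := mul_one _
    have hfin : P (Tset X n M \ Tset X n (M+1)) ≠ ∞ := measure_ne_top _ _
    refine (ENNReal.add_le_add_iff_right hfin).1 ?_
    rw [← hP, add_assoc]
    exact (add_le_add le_rfl (hA.trans hB)).trans ih

/-! unboundedness of the maximal local time -/

def Dset (X : ℕ → Ω → ℤ) (L b : ℕ) : Set Ω :=
  {ω | ∀ i ∈ Finset.Ico (2*L*b) (2*L*b+2*L), X i ω = if Even i then 1 else -1}

lemma D_det (X : ℕ → Ω → ℤ) (L b : ℕ) :
    Det X (Finset.Ico (2*L*b) (2*L*b+2*L)) (· ∈ Dset X L b) := by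
  intro ω ω' h
  simp only [Dset, Set.mem_ofPred_eq, eq_iff_iff]
  exact forall₂_congr fun i hi => by rw [h i hi]

lemma D_prob [MeasurableSpace Ω] (P : Measure Ω)
    (X : ℕ → Ω → ℤ) (p q : ℝ) (hq : q < 1/2) (hpq : p + q = 1)
    (hX : IsAsymmetricSRW P X p q) (L b : ℕ) :
    ENNReal.ofReal q ^ (2*L) ≤ P (Dset X L b) := by
  obtain ⟨hm, hI, h1, h2⟩ := hX
  have e : Dset X L b = ⋂ i ∈ Finset.Ico (2*L*b) (2*L*b+2*L),
      X i ⁻¹' {if Even i then (1:ℤ) else -1} := by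
    ext ω; simp [Dset]
  rw [e, hI.measure_inter_preimage_eq_mul _ (fun i _ => measurableSet_singleton _)]
  have hc : (Finset.Ico (2*L*b) (2*L*b+2*L)).card = 2*L := by simp
  conv_lhs => rw [← hc, ← Finset.prod_const]
  refine Finset.prod_le_prod' fun i _ => ?_
  split_ifs
  · calc _ ≤ ENNReal.ofReal p := ENNReal.ofReal_le_ofReal (by linarith)
      _ = _ := (h1 i).symm
  · exact (h2 i).ge

lemma D_max (X : ℕ → Ω → ℤ) (L b : ℕ) (ω : Ω) (h : ω ∈ Dset X L b) :
    L ≤ maxLocalTime X (2*L*b+2*L) ω := by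
  have key : ∀ i ≤ L, S X (2*L*b+2*i) ω = S X (2*L*b) ω := by
    intro i
    induction i with
    | zero => simp
    | succ i ih =>
      intro hi
      have a := h (2*L*b+2*i) (by simp; omega)
      have b' := h (2*L*b+2*i+1) (by simp; omega)
      have ev : Even (2*L*b+2*i) := ⟨L*b+i, by ring⟩
      rw [if_pos ev] at a
      rw [if_neg (by rw [Nat.even_add_one]; simpa using ev)] at b'
      have := ih (by omega)
      rw [show 2*L*b+2*(i+1) = 2*L*b+2*i+1+1 by ring, S_succ, S_succ, a, b', this]
      ring
  refine le_trans ?_ (lt_le_max X (S X (2*L*b) ω) _ ω)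
  unfold localTime
  have hinj : Function.Injective (fun i : ℕ => 2*L*b+2*(i+1)) := by
    intro i j hij
    simp only at hij
    omega
  calc L = ((Finset.range L).image (fun i : ℕ => 2*L*b+2*(i+1))).card := by
        rw [Finset.card_image_of_injective _ hinj, Finset.card_range]
    _ ≤ _ := by
        apply Finset.card_le_card
        intro t ht
        simp only [Finset.mem_image, Finset.mem_range] at ht
        obtain ⟨i, hi, rfl⟩ := ht
        simp only [Finset.mem_filter, Finset.mem_Icc]
        exact ⟨by omega, key _ (by omega)⟩

lemma max_unbdd [MeasurableSpace Ω] (P : Measure Ω) [IsProbabilityMeasure P]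
    (X : ℕ → Ω → ℤ) (p q : ℝ) (hq0 : 0 < q) (hq : q < 1/2) (hpq : p + q = 1)
    (hX : IsAsymmetricSRW P X p q) : ∀ᵐ ω ∂P, ∀ L, ∃ n, L ≤ maxLocalTime X n ω := by
  rw [ae_all_iff]
  intro L
  have hD := D_prob P X p q hq hpq hX L
  obtain ⟨hm, hI, h1, h2⟩ := hX
  set ε := ENNReal.ofReal q ^ (2*L)
  have hε : 0 < ε := by
    apply ENNReal.pow_pos
    simpa using hq0
  have hDm : ∀ b, MeasurableSet (Dset X L b) := fun b => (D_det X L b).measurableSet hm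
  have hbound : ∀ M, P {ω | ∀ b < M, ω ∉ Dset X L b} ≤ (1 - ε) ^ M := by
    intro M
    induction M with
    | zero => simp
    | succ M ih =>
      have e : {ω | ∀ b < M+1, ω ∉ Dset X L b}
          = {ω | ∀ b < M, ω ∉ Dset X L b} ∩ (Dset X L M)ᶜ := by
        ext ω
        simp only [Set.mem_ofPred_eq, Set.mem_inter_iff, Set.mem_compl_iff]
        constructor
        · intro h; exact ⟨fun b hb => h b (by omega), h M (by omega)⟩
        · rintro ⟨h, h'⟩ b hb
          rcases Nat.lt_succ_iff_lt_or_eq.1 hb with hb | rfl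
          · exact h b hb
          · exact h'
      have d1 : Det X (Finset.range (2*L*M)) (· ∈ {ω | ∀ b < M, ω ∉ Dset X L b}) := by
        intro ω ω' h
        simp only [Set.mem_ofPred_eq, eq_iff_iff]
        refine forall₂_congr fun b hb => not_congr ?_
        refine (D_det X L b ω ω' fun i hi => h i ?_).to_iff
        simp only [Finset.mem_Ico, Finset.mem_range] at hi ⊢
        have : 2*L*(b+1) ≤ 2*L*M := Nat.mul_le_mul_left _ hb
        rw [mul_add] at this
        omega
      have d2 : Det X (Finset.Ico (2*L*M) (2*L*M+2*L)) (· ∈ (Dset X L M)ᶜ) := by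
        intro ω ω' h
        have := D_det X L M ω ω' h
        simp only [Set.mem_compl_iff, eq_iff_iff] at this ⊢
        exact not_congr this
      have hdj : Disjoint (Finset.range (2*L*M)) (Finset.Ico (2*L*M) (2*L*M+2*L)) := by
        rw [Finset.disjoint_left]
        intro i hi hi'
        simp only [Finset.mem_Ico, Finset.mem_range] at hi hi'
        omega
      rw [e, Det.inter_mul hm hI hdj d1 d2, pow_succ, prob_compl_eq_one_sub (hDm M)]
      exact mul_le_mul' ih (tsub_le_tsub_left (hD M) 1)
  have hlim : Tendsto (fun M => (1 - ε) ^ M) atTop (nhds 0) :=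
    ENNReal.tendsto_pow_atTop_nhds_zero_of_lt_one
      (ENNReal.sub_lt_self ENNReal.one_ne_top one_ne_zero hε.ne')
  have hz : P {ω | ∀ b, ω ∉ Dset X L b} = 0 := by
    refine le_antisymm (ge_of_tendsto' hlim fun M => ?_) zero_le
    refine (measure_mono ?_).trans (hbound M)
    intro ω h b _
    exact h b
  have : ∀ᵐ ω ∂P, ¬ ∀ b, ω ∉ Dset X L b := by
    rw [ae_iff]; simpa using hz
  filter_upwards [this] with ω hω
  push Not at hω
  obtain ⟨b, hb⟩ := hω
  exact ⟨_, D_max X L b ω hb⟩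

lemma A_prob [MeasurableSpace Ω] (P : Measure Ω) [IsProbabilityMeasure P]
    (X : ℕ → Ω → ℤ) (p q : ℝ) (hq0 : 0 < q) (hq : q < 1/2) (hpq : p + q = 1)
    (hX : IsAsymmetricSRW P X p q) (m : ℕ) (hm1 : 1 ≤ m) (j : ℕ) :
    ENNReal.ofReal (1 - 2*q) ^ j ≤ P (⋃ n, Bset X (j+1) m n) := by
  have hunb := max_unbdd P X p q hq0 hq hpq hX
  have hT := T_prob P X p q hq0 hq hpq hX
  obtain ⟨hm, hI, h1, h2⟩ := hX
  induction j with
  | zero =>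
    have : ∀ᵐ ω ∂P, ω ∈ ⋃ n, Bset X (0+1) m n := by
      filter_upwards [hunb] with ω hω
      exact Set.mem_iUnion.2 (base_step X m hm1 ω (hω m))
    have h3 : P (⋃ n, Bset X (0+1) m n) = P Set.univ :=
      measure_congr (eventuallyEq_univ.2 this)
    rw [pow_zero, h3, measure_univ]
  | succ j ih =>
    set c := ENNReal.ofReal (1-2*q)
    set B := Bset X (j+1) m
    have hBm : ∀ n, MeasurableSet (B n) := fun n => (B_det X (j+1) m n).measurableSet hm
    have hTm : ∀ n N, MeasurableSet (Tset X n N) := fun n N => (T_det X n N).measurableSet hm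
    set C : ℕ → Set Ω := disjointed B
    have hCm : ∀ n, MeasurableSet (C n) := fun n => MeasurableSet.disjointed hBm n
    have hCB : ∀ n, C n ⊆ B n := fun n => disjointed_subset B n
    have hCd : ∀ n, Det X (Finset.range n) (· ∈ C n) := by
      intro n ω ω' h
      have hh : ∀ i ≤ n, (ω ∈ B i ↔ ω' ∈ B i) := fun i hi =>
        (B_det X (j+1) m i ω ω' (fun l hl => h l (by simp at hl ⊢; omega))).to_iff
      have e : C n = {ω | ω ∈ B n ∧ ∀ i < n, ω ∉ B i} := by
        ext ω
        simp [C, disjointed_eq_inter_compl]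
      rw [e]
      simp only [Set.mem_ofPred_eq, eq_iff_iff]
      rw [hh n le_rfl]
      exact and_congr_right fun _ => forall₂_congr fun i hi => not_congr (hh i (by omega))
    set E : ℕ → Set Ω := fun n => ⋂ N, Tset X n (N+1)
    have hEm : ∀ n, MeasurableSet (E n) := fun n => MeasurableSet.iInter fun N => hTm n (N+1)
    have hCE : ∀ n, P (C n) * c ≤ P (C n ∩ E n) := by
      intro n
      have e : C n ∩ E n = ⋂ N, (C n ∩ Tset X n (N+1)) := by
        rw [Set.inter_iInter]
      rw [e]
      have ht := tendsto_measure_iInter_atTop (μ := P) (s := fun N => C n ∩ Tset X n (N+1))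
        (fun N => ((hCm n).inter (hTm n (N+1))).nullMeasurableSet)
        (antitone_nat_of_succ_le fun N => Set.inter_subset_inter_right _ (T_anti X n (N+1)))
        ⟨0, measure_ne_top _ _⟩
      refine ge_of_tendsto' ht fun N => ?_
      have hdj : Disjoint (Finset.range n) (Finset.Ico n (n+(N+1))) := by
        rw [Finset.disjoint_left]
        intro i hi hi'
        simp only [Finset.mem_Ico, Finset.mem_range] at hi hi'
        omega
      simp only [Function.comp]
      rw [Det.inter_mul hm hI hdj (hCd n) (T_det X n (N+1))]
      exact mul_le_mul_right (hT n N) _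
    have hdisj : Pairwise (Function.onFun Disjoint C) := disjoint_disjointed B
    calc c ^ (j+1) = c ^ j * c := pow_succ _ _
      _ ≤ P (⋃ n, B n) * c := mul_le_mul_left ih _
      _ = P (⋃ n, C n) * c := by rw [iUnion_disjointed]
      _ = ∑' n, P (C n) * c := by rw [measure_iUnion hdisj hCm, ENNReal.tsum_mul_right]
      _ ≤ ∑' n, P (C n ∩ E n) := ENNReal.tsum_le_tsum hCE
      _ = P (⋃ n, C n ∩ E n) := by
          rw [measure_iUnion _ (fun n => (hCm n).inter (hEm n))]
          intro a b hab
          exact (hdisj hab).mono Set.inter_subset_left Set.inter_subset_left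
      _ ≤ P (⋃ n, Bset X (j+1+1) m n) := by
          apply measure_mono_ae
          filter_upwards [hunb] with ω hω hmem
          obtain ⟨n, hC, hE⟩ := Set.mem_iUnion.1 hmem
          refine Set.mem_iUnion.2 (ind_step X (j+1) m n (by omega) ω (hCB n hC) ?_ ?_)
          · intro i
            exact Set.mem_iInter.1 hE i i (by omega)
          · obtain ⟨n', hn'⟩ := hω (m+1+n)
            have := max_le_n X n' ω
            exact ⟨n', by omega, by omega⟩

/-- For every positive integer `k`,
`P(#K(n) = k for infinitely many n) ≥ (1-2q)^k`. -/
theorem prob_k_favorite_sites_io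
    [MeasurableSpace Ω] (P : Measure Ω) [IsProbabilityMeasure P]
    (X : ℕ → Ω → ℤ) (p q : ℝ) (hq0 : 0 < q) (hq : q < 1/2) (hpq : p + q = 1)
    (hX : IsAsymmetricSRW P X p q) (k : ℕ) (hk : 1 ≤ k) :
    ENNReal.ofReal ((1 - 2*q) ^ k)
      ≤ P {ω | ∃ᶠ n in atTop, (favSites X n ω).ncard = k} := by
  have hA := A_prob P X p q hq0 hq hpq hX
  obtain ⟨hm, hI, h1, h2⟩ := hX
  obtain ⟨j, rfl⟩ := Nat.exists_eq_add_of_le' hk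
  set A : ℕ → Set Ω := fun m => ⋃ n, Bset X (j+1) m n
  have hAm : ∀ m, MeasurableSet (A m) := fun m =>
    MeasurableSet.iUnion fun n => (B_det X (j+1) m n).measurableSet hm
  have hsub : (⋂ M, ⋃ m, A (M + m + 1)) ⊆ {ω | ∃ᶠ n in atTop, (favSites X n ω).ncard = j+1} := by
    intro ω hω
    simp only [Set.mem_ofPred_eq]
    rw [frequently_atTop]
    intro M
    obtain ⟨m, hm'⟩ := Set.mem_iUnion.1 (Set.mem_iInter.1 hω M)
    obtain ⟨n, hn⟩ := Set.mem_iUnion.1 hm'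
    have := max_le_n X n ω
    have h3 := hn.1
    exact ⟨n, by omega, hn.2.1⟩
  refine le_trans ?_ (measure_mono hsub)
  have ht := tendsto_measure_iInter_atTop (μ := P) (s := fun M => ⋃ m, A (M + m + 1))
    (fun M => (MeasurableSet.iUnion fun m => hAm _).nullMeasurableSet)
    (antitone_nat_of_succ_le fun M => Set.iUnion_subset fun m => by
      have : M + 1 + m + 1 = M + (m+1) + 1 := by ring
      rw [this]
      exact Set.subset_iUnion (fun m => A (M + m + 1)) (m+1))
    ⟨0, measure_ne_top _ _⟩
  refine ge_of_tendsto' ht fun M => ?_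
  rw [ENNReal.ofReal_pow (by linarith), pow_succ]
  calc ENNReal.ofReal (1-2*q) ^ j * ENNReal.ofReal (1-2*q)
      ≤ ENNReal.ofReal (1-2*q) ^ j * 1 :=
        mul_le_mul_right (ENNReal.ofReal_le_one.2 (by linarith)) _
    _ = ENNReal.ofReal (1-2*q) ^ j := mul_one _
    _ ≤ P (A (M+0+1)) := hA _ (by omega) j
    _ ≤ _ := measure_mono (Set.subset_iUnion (fun m => A (M + m + 1)) 0)
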